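/- Let μ and ν be Borel probability measures on ℝ, with h_μ(z) = 1/G_μ(z) − z and h_ν(z) = 1/G_ν(z) − z on the upper half-plane ℂ⁺. Fix b ∈ ℂ⁺ and define f_b(ω) = h_ν(h_μ(ω) + b) + b for ω ∈ ℂ⁺. Then f_b has a unique fixed point ω₁(b) in ℂ⁺; moreover Im(ω₁(b)) ≥ Im(b), and for every ω ∈ ℂ⁺ the iterates f_b^{∘n}(ω) converge to ω₁(b) as n → ∞. -/

import Mathlib

open MeasureTheory Complex Filter Topology

/-- The Schwarz–Pick inequality for self-maps of the upper half-plane. -/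
def SchwarzPick (h : ℂ → ℂ) : Prop :=
  ∀ z w : ℂ, 0 < z.im → 0 < w.im →
    ‖h z - h w‖ ^ 2 * (z.im * w.im) ≤ ‖z - w‖ ^ 2 * ((h z).im * (h w).im)

section CauchyTransform

lemma abs_im_le_norm_sub_ofReal (z : ℂ) (x : ℝ) : |z.im| ≤ ‖z - x‖ := by
  simpa using Complex.abs_im_le_norm (z - x)

lemma sub_ofReal_ne_zero {z : ℂ} (hz : z.im ≠ 0) (x : ℝ) : z - x ≠ 0 :=
  norm_pos_iff.1 ((abs_pos.2 hz).trans_le (abs_im_le_norm_sub_ofReal z x))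

lemma continuous_inv_sub_ofReal {z : ℂ} (hz : z.im ≠ 0) :
    Continuous fun x : ℝ => (z - (x : ℂ))⁻¹ :=
  (continuous_const.sub continuous_ofReal).inv₀ (sub_ofReal_ne_zero hz)

lemma norm_inv_sub_ofReal_le {z : ℂ} (hz : z.im ≠ 0) (x : ℝ) :
    ‖(z - (x : ℂ))⁻¹‖ ≤ |z.im|⁻¹ := by
  rw [norm_inv]
  exact inv_anti₀ (abs_pos.2 hz) (abs_im_le_norm_sub_ofReal z x)

lemma norm_integral_mul_sq_le {μ : Measure ℝ} {u v : ℝ → ℂ} (hu : MemLp u 2 μ) (hv : MemLp v 2 μ) :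
    ‖∫ x, u x * v x ∂μ‖ ^ 2 ≤ (∫ x, ‖u x‖ ^ 2 ∂μ) * ∫ x, ‖v x‖ ^ 2 ∂μ := by
  have h1 : ‖∫ x, u x * v x ∂μ‖ ≤ ∫ x, ‖u x‖ * ‖v x‖ ∂μ := by
    simpa using norm_integral_le_integral_norm (μ := μ) fun x => u x * v x
  have h2 := integral_mul_norm_le_Lp_mul_Lq (μ := μ) Real.HolderConjugate.two_two
    (f := u) (g := v) (by simpa using hu) (by simpa using hv)
  simp only [Real.rpow_two, ← Real.sqrt_eq_rpow] at h2
  have hU : 0 ≤ ∫ x, ‖u x‖ ^ 2 ∂μ := integral_nonneg fun x => by positivity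
  have hV : 0 ≤ ∫ x, ‖v x‖ ^ 2 ∂μ := integral_nonneg fun x => by positivity
  calc ‖∫ x, u x * v x ∂μ‖ ^ 2
      ≤ (√(∫ x, ‖u x‖ ^ 2 ∂μ) * √(∫ x, ‖v x‖ ^ 2 ∂μ)) ^ 2 := by
        gcongr
        exact h1.trans h2
    _ = _ := by rw [mul_pow, Real.sq_sqrt hU, Real.sq_sqrt hV]

variable (μ : Measure ℝ) [IsProbabilityMeasure μ]

lemma memLp_inv_sub_ofReal {z : ℂ} (hz : z.im ≠ 0) (p : ENNReal) :
    MemLp (fun x : ℝ => (z - (x : ℂ))⁻¹) p μ :=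
  MemLp.of_bound (continuous_inv_sub_ofReal hz).aestronglyMeasurable _
    (Eventually.of_forall (norm_inv_sub_ofReal_le hz))

lemma integrable_inv_sub_ofReal {z : ℂ} (hz : z.im ≠ 0) :
    Integrable (fun x : ℝ => (z - (x : ℂ))⁻¹) μ :=
  memLp_one_iff_integrable.1 (memLp_inv_sub_ofReal μ hz 1)

lemma integral_inv_sub_ofReal_ne_zero {z : ℂ} (hz : z.im ≠ 0) :
    ∫ x : ℝ, (z - (x : ℂ))⁻¹ ∂μ ≠ 0 := by
  intro h0
  have him : ∫ x : ℝ, ((z - (x : ℂ))⁻¹).im ∂μ = 0 := by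
    have := integral_im (integrable_inv_sub_ofReal μ hz)
    simpa [h0] using this
  have hcont : Continuous fun x : ℝ => (normSq (z - (x : ℂ)))⁻¹ :=
    (continuous_normSq.comp (continuous_const.sub continuous_ofReal)).inv₀
      fun x => (normSq_pos.2 (sub_ofReal_ne_zero hz x)).ne'
  have hpos : ∀ x : ℝ, 0 < (normSq (z - (x : ℂ)))⁻¹ := fun x =>
    inv_pos.2 (normSq_pos.2 (sub_ofReal_ne_zero hz x))
  have hform : (fun x : ℝ => ((z - (x : ℂ))⁻¹).im) =
      fun x : ℝ => -z.im * (normSq (z - (x : ℂ)))⁻¹ := by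
    funext x
    simp [inv_im, div_eq_mul_inv]
  have hint : Integrable (fun x : ℝ => (normSq (z - (x : ℂ)))⁻¹) μ := by
    have := (integrable_inv_sub_ofReal μ hz).im.const_mul (-z.im)⁻¹
    refine this.congr (Eventually.of_forall fun x => ?_)
    have := congrFun hform x
    change (-z.im)⁻¹ * ((z - (x : ℂ))⁻¹).im = _
    rw [show ((z - (x : ℂ))⁻¹).im = _ from this, inv_mul_cancel_left₀ (neg_ne_zero.2 hz)]
  rw [hform, integral_const_mul] at him
  have hzero := (mul_eq_zero.1 him).resolve_left (neg_ne_zero.2 hz)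
  rw [integral_eq_zero_iff_of_nonneg (fun x => (hpos x).le) hint] at hzero
  obtain ⟨x, hx⟩ := hzero.exists
  exact (hpos x).ne' hx

/-- The reciprocal Cauchy transform `F` of `μ` satisfies a difference-quotient identity in terms
of the functions `x ↦ F z / (z - x) - 1`. -/
lemma inv_integral_sub_inv_integral {z w : ℂ} (hz : z.im ≠ 0) (hw : w.im ≠ 0) :
    (∫ x : ℝ, (z - (x : ℂ))⁻¹ ∂μ)⁻¹ - z - ((∫ x : ℝ, (w - (x : ℂ))⁻¹ ∂μ)⁻¹ - w) =
      (z - w) * ∫ x : ℝ, ((∫ x : ℝ, (z - (x : ℂ))⁻¹ ∂μ)⁻¹ * (z - (x : ℂ))⁻¹ - 1) *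
        ((∫ x : ℝ, (w - (x : ℂ))⁻¹ ∂μ)⁻¹ * (w - (x : ℂ))⁻¹ - 1) ∂μ := by
  have hGz := integral_inv_sub_ofReal_ne_zero μ hz
  have hGw := integral_inv_sub_ofReal_ne_zero μ hw
  have hiz := integrable_inv_sub_ofReal μ hz
  have hiw := integrable_inv_sub_ofReal μ hw
  rw [← integral_const_mul]
  generalize hgz : ∫ x : ℝ, (z - (x : ℂ))⁻¹ ∂μ = Gz at *
  generalize hgw : ∫ x : ℝ, (w - (x : ℂ))⁻¹ ∂μ = Gw at *
  have key : ∀ x : ℝ, (z - w) * ((Gz⁻¹ * (z - (x : ℂ))⁻¹ - 1) * (Gw⁻¹ * (w - (x : ℂ))⁻¹ - 1)) =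
      (-(Gz⁻¹ * Gw⁻¹) - (z - w) * Gz⁻¹) * (z - (x : ℂ))⁻¹ +
        (Gz⁻¹ * Gw⁻¹ - (z - w) * Gw⁻¹) * (w - (x : ℂ))⁻¹ + (z - w) := by
    intro x
    have hzx := sub_ofReal_ne_zero hz x
    have hwx := sub_ofReal_ne_zero hw x
    field_simp
    ring
  simp_rw [key]
  rw [integral_add (by exact (hiz.const_mul _).add (hiw.const_mul _)) (integrable_const _),
    integral_add (by exact hiz.const_mul _) (by exact hiw.const_mul _), integral_const_mul, integral_const_mul,
    hgz, hgw, integral_const]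
  simp only [probReal_univ, one_smul]
  field_simp
  ring

lemma memLp_inv_integral_mul_inv_sub_one {z : ℂ} (hz : z.im ≠ 0) (p : ENNReal) :
    MemLp (fun x : ℝ => (∫ x : ℝ, (z - (x : ℂ))⁻¹ ∂μ)⁻¹ * (z - (x : ℂ))⁻¹ - 1) p μ :=
  ((memLp_inv_sub_ofReal μ hz p).const_mul _).sub (memLp_const 1)

lemma im_inv_integral_sub {z : ℂ} (hz : z.im ≠ 0) :
    ((∫ x : ℝ, (z - (x : ℂ))⁻¹ ∂μ)⁻¹ - z).im =
      z.im * ∫ x : ℝ, ‖(∫ x : ℝ, (z - (x : ℂ))⁻¹ ∂μ)⁻¹ * (z - (x : ℂ))⁻¹ - 1‖ ^ 2 ∂μ := by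
  have hconj : ∫ x : ℝ, ((starRingEnd ℂ) z - (x : ℂ))⁻¹ ∂μ =
      (starRingEnd ℂ) (∫ x : ℝ, (z - (x : ℂ))⁻¹ ∂μ) := by
    rw [← integral_conj]
    simp
  have h := inv_integral_sub_inv_integral μ hz (w := (starRingEnd ℂ) z) (by simpa using hz)
  rw [hconj] at h
  generalize ∫ x : ℝ, (z - (x : ℂ))⁻¹ ∂μ = G at *
  have hprod : ∀ x : ℝ, (G⁻¹ * (z - (x : ℂ))⁻¹ - 1) *
      (((starRingEnd ℂ) G)⁻¹ * ((starRingEnd ℂ) z - (x : ℂ))⁻¹ - 1) =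
      ((‖G⁻¹ * (z - (x : ℂ))⁻¹ - 1‖ ^ 2 : ℝ) : ℂ) := by
    intro x
    rw [ofReal_pow, ← Complex.mul_conj']
    simp
  simp_rw [hprod] at h
  rw [integral_complex_ofReal] at h
  have him := congrArg Complex.im h
  simp only [sub_im, inv_im, conj_im, normSq_conj, im_mul_ofReal, neg_neg, neg_div] at him ⊢
  linarith

lemma im_inv_integral_sub_nonneg {z : ℂ} (hz : 0 < z.im) :
    0 ≤ ((∫ x : ℝ, (z - (x : ℂ))⁻¹ ∂μ)⁻¹ - z).im := by
  rw [im_inv_integral_sub μ hz.ne']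
  exact mul_nonneg hz.le (integral_nonneg fun x => by positivity)

lemma schwarzPick_inv_integral_sub :
    SchwarzPick fun z => (∫ x : ℝ, (z - (x : ℂ))⁻¹ ∂μ)⁻¹ - z := by
  intro z w hz hw
  simp only
  rw [inv_integral_sub_inv_integral μ hz.ne' hw.ne', im_inv_integral_sub μ hz.ne',
    im_inv_integral_sub μ hw.ne', norm_mul, mul_pow]
  have hcs := norm_integral_mul_sq_le (memLp_inv_integral_mul_inv_sub_one μ hz.ne' 2)
    (memLp_inv_integral_mul_inv_sub_one μ hw.ne' 2)
  calc _ = (‖z - w‖ ^ 2 * (z.im * w.im)) * _ := by ring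
    _ ≤ (‖z - w‖ ^ 2 * (z.im * w.im)) * _ := mul_le_mul_of_nonneg_left hcs (by positivity)
    _ = _ := by ring

lemma tendsto_im_inv_integral_sub_div :
    Tendsto (fun y : ℝ => ((∫ x : ℝ, ((y * I : ℂ) - (x : ℂ))⁻¹ ∂μ)⁻¹ - y * I).im / y)
      atTop (𝓝 0) := by
  have hlim : Tendsto (fun y : ℝ => ∫ x : ℝ, (y : ℂ) * ((y * I : ℂ) - (x : ℂ))⁻¹ ∂μ) atTop
      (𝓝 (∫ _ : ℝ, I⁻¹ ∂μ)) := by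
    refine tendsto_integral_filter_of_dominated_convergence (fun _ => 1) ?_ ?_
      (integrable_const _) (Eventually.of_forall fun x => ?_)
    · filter_upwards [eventually_gt_atTop 0] with y hy
      exact (continuous_const.mul
        (continuous_inv_sub_ofReal (by simpa using hy.ne'))).aestronglyMeasurable
    · filter_upwards [eventually_gt_atTop 0] with y hy
      refine Eventually.of_forall fun x => ?_
      have h := norm_inv_sub_ofReal_le (z := y * I) (by simpa using hy.ne') x
      have him : ((y : ℂ) * I).im = y := by simp
      rw [him] at h
      rw [norm_mul, norm_real, Real.norm_eq_abs]
      calc |y| * _ ≤ |y| * |y|⁻¹ := by gcongr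
        _ = 1 := mul_inv_cancel₀ (abs_pos.2 hy.ne').ne'
    · have h0 : Tendsto (fun y : ℝ => (x : ℂ) * ((y⁻¹ : ℝ) : ℂ)) atTop (𝓝 0) := by
        simpa using ((continuous_ofReal.tendsto _).comp tendsto_inv_atTop_zero).const_mul (x : ℂ)
      have h1 : Tendsto (fun y : ℝ => (I - (x : ℂ) * ((y⁻¹ : ℝ) : ℂ))⁻¹) atTop (𝓝 (I⁻¹)) := by
        simpa using (h0.const_sub I).inv₀ (by simp)
      refine h1.congr' ?_
      filter_upwards [eventually_gt_atTop 0] with y hy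
      have hyc : (y : ℂ) ≠ 0 := ofReal_ne_zero.2 hy.ne'
      have : (y : ℂ) * I - x = y * (I - (x : ℂ) * ((y⁻¹ : ℝ) : ℂ)) := by
        push_cast
        field_simp
      rw [this, mul_inv, mul_inv_cancel_left₀ hyc]
  have hinv : Tendsto (fun y : ℝ => ((∫ x : ℝ, (y : ℂ) * ((y * I : ℂ) - (x : ℂ))⁻¹ ∂μ)⁻¹ - I).im)
      atTop (𝓝 0) := by
    have := (hlim.inv₀ (by simp)).sub_const I
    simpa [Function.comp_def, -sub_im, -inv_im] using (continuous_im.tendsto _).comp this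
  refine hinv.congr' ?_
  filter_upwards [eventually_gt_atTop 0] with y hy
  have hyc : (y : ℂ) ≠ 0 := ofReal_ne_zero.2 hy.ne'
  rw [integral_const_mul, ← div_ofReal_im, mul_inv]
  congr 1
  field_simp

end CauchyTransform

section FixedPoint

/-- If `k` has sublinear imaginary part along the imaginary axis, then `φ ∘ k + c` cannot push
every point of the imaginary axis upwards. -/
lemma exists_im_comp_add_lt {φ k : ℂ → ℂ} (hφ : SchwarzPick φ) (hk : SchwarzPick k)
    (hφ_nonneg : ∀ z : ℂ, 0 < z.im → 0 ≤ (φ z).im) {c : ℝ} (hc : 0 < c)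
    (hk_im : ∀ z : ℂ, 0 < z.im → c ≤ (k z).im)
    (hk_lim : Tendsto (fun y : ℝ => (k (y * I)).im / y) atTop (𝓝 0)) :
    ∃ p : ℂ, 0 < p.im ∧ (φ (k p)).im + c < p.im := by
  by_contra! hcon
  have hI : ∀ y : ℝ, ((y : ℂ) * I).im = y := fun y => by simp
  set P := k I
  set A := (φ P).im
  have hPc : c ≤ P.im := hk_im I (by simp)
  have hP0 : 0 < P.im := hc.trans_le hPc
  have hA0 : 0 ≤ A := hφ_nonneg P hP0
  have hlower : ∀ y : ℝ, 2 * A + 2 * c < y →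
      y * (P.im * (k (y * I)).im) ≤ 8 * A * ‖P - k (y * I)‖ ^ 2 := by
    intro y hy
    have hy0 : 0 < ((y : ℂ) * I).im := by rw [hI]; linarith
    have hQ0 : 0 < (k (y * I)).im := hc.trans_le (hk_im _ hy0)
    have hT : y ≤ (φ (k (y * I))).im + c := by simpa [hI] using hcon _ hy0
    have hsp := hφ P _ hP0 hQ0
    set Q := k (y * I)
    set T := (φ Q).im
    have hnorm : T - A ≤ ‖φ P - φ Q‖ := by
      have := Complex.abs_im_le_norm (φ P - φ Q)
      rw [sub_im] at this
      linarith [neg_abs_le ((φ P).im - (φ Q).im)]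
    have hT0 : 0 < T := by linarith
    have hPQ : 0 < P.im * Q.im := mul_pos hP0 hQ0
    have hsq : T ^ 2 / 4 ≤ ‖φ P - φ Q‖ ^ 2 := by
      have : T / 2 ≤ ‖φ P - φ Q‖ := by linarith
      nlinarith
    have h1 : T * (T * (P.im * Q.im)) ≤ T * (4 * A * ‖P - Q‖ ^ 2) := by
      have := mul_le_mul_of_nonneg_right hsq hPQ.le
      nlinarith
    have h2 := le_of_mul_le_mul_left h1 hT0
    have h3 : y * (P.im * Q.im) ≤ (2 * T) * (P.im * Q.im) :=
      mul_le_mul_of_nonneg_right (by linarith) hPQ.le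
    linarith
  have hgrowth : ∀ y : ℝ, 0 < y → y * P.im ≤ 32 * A * (k (y * I)).im := by
    intro y hy
    have hy0 : 0 < ((y : ℂ) * I).im := by rwa [hI]
    have hQ0 : 0 < (k (y * I)).im := hc.trans_le (hk_im _ hy0)
    set Q := k (y * I)
    obtain ⟨s, hs⟩ := exists_gt
      (max (max y (2 * A + 2 * c)) (32 * A * ‖P - Q‖ ^ 2 / (P.im * c)))
    simp only [max_lt_iff] at hs
    obtain ⟨⟨hys, hAs⟩, hDs⟩ := hs
    have hs0 : 0 < s := hy.trans hys
    have hs0' : 0 < ((s : ℂ) * I).im := by rwa [hI]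
    have hS := hk_im _ hs0'
    have hlow := hlower s hAs
    have hup := hk _ _ hy0 hs0'
    have hnorm : ‖(y : ℂ) * I - s * I‖ = s - y := by
      rw [← sub_mul, norm_mul, norm_I, mul_one, ← ofReal_sub, norm_real, Real.norm_eq_abs,
        abs_of_neg (by linarith)]
      ring
    rw [hnorm, hI, hI] at hup
    change ‖Q - _‖ ^ 2 * _ ≤ _ * (Q.im * _) at hup
    set S := k (s * I)
    have hS0 : 0 < S.im := hc.trans_le hS
    have hfar : 2 * ‖P - Q‖ ≤ ‖P - S‖ := by
      by_contra! hlt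
      have hsq : ‖P - S‖ ^ 2 ≤ 4 * ‖P - Q‖ ^ 2 := by nlinarith [norm_nonneg (P - S)]
      rw [div_lt_iff₀ (by positivity)] at hDs
      have h1 : s * (P.im * c) ≤ s * (P.im * S.im) := by gcongr
      have h2 : 8 * A * ‖P - S‖ ^ 2 ≤ 8 * A * (4 * ‖P - Q‖ ^ 2) := by gcongr
      linarith
    have hhalf : ‖P - S‖ ^ 2 ≤ 4 * ‖Q - S‖ ^ 2 := by
      have := norm_sub_le_norm_sub_add_norm_sub P Q S
      have : ‖P - S‖ ≤ 2 * ‖Q - S‖ := by linarith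
      nlinarith [norm_nonneg (P - S)]
    have hPS : 0 < ‖P - S‖ ^ 2 := by
      have h1 : 0 < s * (P.im * S.im) := by positivity
      by_contra! h
      have h2 : 8 * A * ‖P - S‖ ^ 2 ≤ 0 := mul_nonpos_of_nonneg_of_nonpos (by positivity) h
      linarith
    have hup' : s * (‖Q - S‖ ^ 2 * y) ≤ s * (s * (Q.im * S.im)) := by
      have : (s - y) ^ 2 * (Q.im * S.im) ≤ s ^ 2 * (Q.im * S.im) := by
        gcongr
        linarith
      linarith
    have hup'' := le_of_mul_le_mul_left hup' hs0
    refine le_of_mul_le_mul_left (a := ‖P - S‖ ^ 2) ?_ hPS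
    calc ‖P - S‖ ^ 2 * (y * P.im) ≤ 4 * ‖Q - S‖ ^ 2 * (y * P.im) := by gcongr
      _ = 4 * P.im * (‖Q - S‖ ^ 2 * y) := by ring
      _ ≤ 4 * P.im * (s * (Q.im * S.im)) := by gcongr
      _ = 4 * Q.im * (s * (P.im * S.im)) := by ring
      _ ≤ 4 * Q.im * (8 * A * ‖P - S‖ ^ 2) := by gcongr
      _ = ‖P - S‖ ^ 2 * (32 * A * Q.im) := by ring
  have hzero : Tendsto (fun y : ℝ => 32 * A * ((k (y * I)).im / y)) atTop (𝓝 0) := by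
    simpa using hk_lim.const_mul (32 * A)
  refine hP0.not_ge (ge_of_tendsto hzero ?_)
  filter_upwards [eventually_gt_atTop 0] with y hy
  rw [← mul_div_assoc, le_div_iff₀ hy]
  linarith [hgrowth y hy]

variable {f : ℂ → ℂ} {c : ℝ}

/-- A point moved downwards by `f` forces every orbit to stay bounded. -/
lemma exists_norm_iterate_le (hc : 0 < c) (hfc : ∀ z : ℂ, 0 < z.im → c ≤ (f z).im)
    (hf : SchwarzPick f) {p : ℂ} (hp : 0 < p.im) (hfp : (f p).im < p.im)
    {ω : ℂ} (hω : 0 < ω.im) : ∃ R : ℝ, ∀ n : ℕ, ‖f^[n] ω - p‖ ≤ R := by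
  have hpos : ∀ n, 0 < (f^[n] ω).im := by
    intro n
    induction n with
    | zero => exact hω
    | succ n ih => rw [Function.iterate_succ_apply']; exact hc.trans_le (hfc _ ih)
  set q := (f p).im / p.im with hq
  have hfp0 : 0 < (f p).im := hc.trans_le (hfc p hp)
  have hq0 : 0 ≤ q := by positivity
  have hq1 : √q < 1 := by
    rw [Real.sqrt_lt' one_pos, one_pow, hq, div_lt_one hp]
    exact hfp
  set D := ‖f p - p‖ / √c
  have hstep : ∀ w : ℂ, 0 < w.im →
      ‖f w - p‖ / √(f w).im ≤ √q * (‖w - p‖ / √w.im) + D := by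
    intro w hw
    have hcw := hfc w hw
    have hfw : 0 < (f w).im := hc.trans_le hcw
    have h1 : ‖f w - f p‖ / √(f w).im ≤ √q * (‖w - p‖ / √w.im) := by
      refine (sq_le_sq₀ (by positivity) (by positivity)).1 ?_
      rw [div_pow, mul_pow, div_pow, Real.sq_sqrt hfw.le, Real.sq_sqrt hq0, Real.sq_sqrt hw.le,
        hq, div_mul_div_comm, div_le_div_iff₀ hfw (by positivity)]
      linarith [hf w p hw hp]
    have h2 : ‖f p - p‖ / √(f w).im ≤ D := by
      have : 0 < √c := Real.sqrt_pos.2 hc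
      exact div_le_div_of_nonneg_left (norm_nonneg _) this (Real.sqrt_le_sqrt hcw)
    calc ‖f w - p‖ / √(f w).im ≤ (‖f w - f p‖ + ‖f p - p‖) / √(f w).im := by
          gcongr
          exact norm_sub_le_norm_sub_add_norm_sub _ _ _
      _ ≤ _ := by rw [add_div]; exact add_le_add h1 h2
  set M := max (‖ω - p‖ / √ω.im) (D / (1 - √q))
  have hDM : D ≤ M * (1 - √q) := by
    rw [← div_le_iff₀ (by linarith)]
    exact le_max_right _ _
  have hbound : ∀ n, ‖f^[n] ω - p‖ / √(f^[n] ω).im ≤ M := by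
    intro n
    induction n with
    | zero => exact le_max_left _ _
    | succ n ih =>
      rw [Function.iterate_succ_apply']
      have h1 := hstep _ (hpos n)
      have h2 := mul_le_mul_of_nonneg_left ih (Real.sqrt_nonneg q)
      linarith
  have hM0 : 0 ≤ M := (by positivity : 0 ≤ ‖ω - p‖ / √ω.im).trans (le_max_left _ _)
  refine ⟨M ^ 2 + p.im, fun n => ?_⟩
  have hn := hpos n
  have h1 := hbound n
  rw [div_le_iff₀ (Real.sqrt_pos.2 hn)] at h1
  have h2 : ‖f^[n] ω - p‖ ^ 2 ≤ M ^ 2 * (f^[n] ω).im := by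
    calc _ ≤ (M * √(f^[n] ω).im) ^ 2 := by gcongr
      _ = _ := by rw [mul_pow, Real.sq_sqrt hn.le]
  have h3 : (f^[n] ω).im ≤ ‖f^[n] ω - p‖ + p.im := by
    have := (le_abs_self _).trans (Complex.abs_im_le_norm (f^[n] ω - p))
    rw [sub_im] at this
    linarith
  by_contra! hlt
  have h4 : M ^ 2 * (f^[n] ω).im ≤ M ^ 2 * (‖f^[n] ω - p‖ + p.im) := by gcongr
  nlinarith [sq_nonneg M]

/-- A Schwarz–Pick map with bounded orbits whose image stays away from the real axis has
convergent orbits. -/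
lemma exists_tendsto_iterate (hc : 0 < c) (hfc : ∀ z : ℂ, 0 < z.im → c ≤ (f z).im)
    (hf : SchwarzPick fun z => f z - c * I)
    {p : ℂ} (hp : 0 < p.im) (hfp : (f p).im < p.im) {ω : ℂ} (hω : c ≤ ω.im) :
    ∃ w : ℂ, c ≤ w.im ∧ f w = w ∧ Tendsto (fun n : ℕ => f^[n] ω) atTop (𝓝 w) := by
  have hsub : ∀ z w : ℂ, 0 < z.im → 0 < w.im → ‖f z - f w‖ ^ 2 * (z.im * w.im) ≤
      ‖z - w‖ ^ 2 * (((f z).im - c) * ((f w).im - c)) := by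
    intro z w hz hw
    simpa using hf z w hz hw
  have hf' : SchwarzPick f := by
    intro z w hz hw
    refine (hsub z w hz hw).trans ?_
    have h1 := hfc z hz
    have h2 := hfc w hw
    gcongr <;> linarith
  obtain ⟨R₀, hR₀⟩ := exists_norm_iterate_le hc hfc hf' hp hfp (hc.trans_le hω)
  have hge : ∀ n, c ≤ (f^[n] ω).im := by
    intro n
    induction n with
    | zero => exact hω
    | succ n ih => rw [Function.iterate_succ_apply']; exact hfc _ (hc.trans_le ih)
  have hpos : ∀ n, 0 < (f^[n] ω).im := fun n => hc.trans_le (hge n)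
  set R := R₀ + p.im
  have hle : ∀ n, (f^[n] ω).im ≤ R := by
    intro n
    have := (le_abs_self _).trans ((Complex.abs_im_le_norm (f^[n] ω - p)).trans (hR₀ n))
    rw [sub_im] at this
    linarith
  have hcR : c ≤ R := (hge 0).trans (hle 0)
  have hR : 0 < R := hc.trans_le hcR
  set r := 1 - c / R with hr
  have hr0 : 0 ≤ r := sub_nonneg.2 ((div_le_one hR).2 hcR)
  have hr1 : r < 1 := by
    have : 0 < c / R := by positivity
    linarith
  have hshrink : ∀ t : ℝ, t ≤ R → t - c ≤ r * t := by
    intro t ht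
    have : c / R * t ≤ c / R * R := by gcongr
    rw [div_mul_cancel₀ _ hR.ne'] at this
    rw [hr]
    linarith
  set d : ℕ → ℝ := fun n => ‖f^[n] ω - f^[n + 1] ω‖ ^ 2 / ((f^[n] ω).im * (f^[n + 1] ω).im) with hd
  have hdstep : ∀ n, d (n + 1) ≤ r ^ 2 * d n := by
    intro n
    have h := hsub _ _ (hpos n) (hpos (n + 1))
    simp only [← Function.iterate_succ_apply' f] at h
    have h0 := hpos n
    have h1 := hpos (n + 1)
    have h2 := hpos (n + 2)
    have e1 := hshrink _ (hle (n + 1))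
    have e2 := hshrink _ (hle (n + 2))
    have g1 := hge (n + 1)
    have g2 := hge (n + 2)
    simp only [hd]
    rw [← mul_div_assoc, div_le_div_iff₀ (by positivity) (by positivity)]
    refine h.trans ?_
    calc _ ≤ ‖f^[n] ω - f^[n + 1] ω‖ ^ 2 * ((r * (f^[n + 1] ω).im) * (r * (f^[n + 2] ω).im)) := by
          gcongr
      _ = _ := by ring
  have hdle : ∀ n, d n ≤ (r ^ n) ^ 2 * d 0 := by
    intro n
    induction n with
    | zero => simp
    | succ n ih =>
      calc d (n + 1) ≤ r ^ 2 * d n := hdstep n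
        _ ≤ r ^ 2 * ((r ^ n) ^ 2 * d 0) := by gcongr
        _ = _ := by ring
  have hd0 : 0 ≤ d 0 := by
    have h0 := hpos 0
    have h1 := hpos 1
    positivity
  have hdist : ∀ n, dist (f^[n] ω) (f^[n + 1] ω) ≤ R * √(d 0) * r ^ n := by
    intro n
    have h0 := hpos n
    have h1 := hpos (n + 1)
    rw [dist_eq_norm]
    refine (sq_le_sq₀ (by positivity) (by positivity)).1 ?_
    calc ‖f^[n] ω - f^[n + 1] ω‖ ^ 2 = d n * ((f^[n] ω).im * (f^[n + 1] ω).im) := by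
          simp only [hd]
          rw [div_mul_cancel₀ _ (by positivity)]
      _ ≤ ((r ^ n) ^ 2 * d 0) * (R * R) := by
          gcongr
          · exact hdle n
          · exact hle n
          · exact hle (n + 1)
      _ = _ := by
          rw [mul_pow, mul_pow, Real.sq_sqrt hd0]
          ring
  obtain ⟨w, hw⟩ := cauchySeq_tendsto_of_complete (cauchySeq_of_le_geometric r _ hr1 hdist)
  have hwc : c ≤ w.im :=
    ge_of_tendsto' ((continuous_im.tendsto w).comp hw) hge
  have hw0 : 0 < w.im := hc.trans_le hwc
  refine ⟨w, hwc, ?_, hw⟩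
  refine tendsto_nhds_unique ?_ (hw.comp (tendsto_add_atTop_nat 1))
  rw [tendsto_iff_norm_sub_tendsto_zero]
  have hlim : Tendsto (fun n => √(R * (f w).im) / c * ‖f^[n] ω - w‖) atTop (𝓝 0) := by
    simpa using (tendsto_iff_norm_sub_tendsto_zero.1 hw).const_mul (√(R * (f w).im) / c)
  refine squeeze_zero (fun _ => norm_nonneg _) (fun n => ?_) hlim
  have hfw : 0 < (f w).im := hc.trans_le (hfc w hw0)
  have h := hf' _ _ (hpos n) hw0
  simp only [Function.comp_apply, Function.iterate_succ_apply'] at *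
  have hle' : (f (f^[n] ω)).im ≤ R := by
    simpa only [Function.iterate_succ_apply'] using hle (n + 1)
  refine (sq_le_sq₀ (by positivity) (by positivity)).1 ?_
  rw [mul_pow, div_pow, Real.sq_sqrt (by positivity), div_mul_eq_mul_div,
    le_div_iff₀ (by positivity)]
  calc ‖f (f^[n] ω) - f w‖ ^ 2 * c ^ 2
      ≤ ‖f (f^[n] ω) - f w‖ ^ 2 * ((f^[n] ω).im * w.im) := by
        rw [sq c]
        gcongr
        · exact (hpos n).le
        · exact hge n
    _ ≤ ‖f^[n] ω - w‖ ^ 2 * ((f (f^[n] ω)).im * (f w).im) := h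
    _ ≤ ‖f^[n] ω - w‖ ^ 2 * (R * (f w).im) := by gcongr
    _ = _ := by ring

lemma eq_of_isFixedPt_of_schwarzPick (hc : 0 < c) (hfc : ∀ z : ℂ, 0 < z.im → c ≤ (f z).im)
    (hf : SchwarzPick fun z => f z - c * I) {z w : ℂ} (hz : 0 < z.im) (hw : 0 < w.im)
    (hfz : f z = z) (hfw : f w = w) : z = w := by
  have h := hf z w hz hw
  have hzc := hfc z hz
  have hwc := hfc w hw
  simp only [hfz, hfw, sub_sub_sub_cancel_right] at h hzc hwc
  simp only [sub_im, mul_im, ofReal_re, ofReal_im, I_re, I_im, mul_one, mul_zero, add_zero] at h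
  by_contra hne
  have hpos : 0 < ‖z - w‖ ^ 2 := by
    have := norm_pos_iff.2 (sub_ne_zero.2 hne)
    positivity
  have := le_of_mul_le_mul_left h hpos
  nlinarith

end FixedPoint

/-- Scalar fixed-point statement of Belinschi–Mai–Speicher subordination (Theorem 3.1 of the
paper, with `B = ℂ`): for Borel probability measures `μ, ν` on `ℝ`, with
`h_μ(z) = 1/G_μ(z) - z`, `h_ν(z) = 1/G_ν(z) - z`, `b` in the upper half-plane, and
`f_b(ω) = h_ν(h_μ(ω) + b) + b`, the map `f_b` has a unique fixed point `ω₁(b)` in the upper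
half-plane; moreover `Im ω₁(b) ≥ Im b`, and for every `ω` in the upper half-plane the
iterates `f_b^{∘n}(ω)` converge to `ω₁(b)`. -/
theorem subordination_fixed_point
    (μ ν : Measure ℝ) [IsProbabilityMeasure μ] [IsProbabilityMeasure ν]
    (Gmu Gnu : ℂ → ℂ)
    (hGmu : ∀ z : ℂ, Gmu z = ∫ x : ℝ, (z - (x : ℂ))⁻¹ ∂μ)
    (hGnu : ∀ z : ℂ, Gnu z = ∫ x : ℝ, (z - (x : ℂ))⁻¹ ∂ν)
    (hmu hnu : ℂ → ℂ)
    (hhmu : ∀ z : ℂ, hmu z = (Gmu z)⁻¹ - z)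
    (hhnu : ∀ z : ℂ, hnu z = (Gnu z)⁻¹ - z)
    (b : ℂ) (hb : 0 < b.im)
    (f : ℂ → ℂ) (hf : ∀ ω : ℂ, f ω = hnu (hmu ω + b) + b) :
    ∃ w : ℂ, (0 < w.im ∧ f w = w) ∧
      (∀ w' : ℂ, 0 < w'.im → f w' = w' → w' = w) ∧
      b.im ≤ w.im ∧
      ∀ ω : ℂ, 0 < ω.im → Tendsto (fun n : ℕ => f^[n] ω) atTop (𝓝 w) := by
  have hmu_eq : hmu = fun z => (∫ x : ℝ, (z - (x : ℂ))⁻¹ ∂μ)⁻¹ - z := by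
    funext z
    rw [hhmu, hGmu]
  have hnu_eq : hnu = fun z => (∫ x : ℝ, (z - (x : ℂ))⁻¹ ∂ν)⁻¹ - z := by
    funext z
    rw [hhnu, hGnu]
  have hmu_nonneg : ∀ z : ℂ, 0 < z.im → 0 ≤ (hmu z).im := fun z hz => by
    rw [hmu_eq]
    exact im_inv_integral_sub_nonneg μ hz
  have hnu_nonneg : ∀ z : ℂ, 0 < z.im → 0 ≤ (hnu z).im := fun z hz => by
    rw [hnu_eq]
    exact im_inv_integral_sub_nonneg ν hz
  have hmu_pick : SchwarzPick hmu := hmu_eq ▸ schwarzPick_inv_integral_sub μ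
  have hnu_pick : SchwarzPick hnu := hnu_eq ▸ schwarzPick_inv_integral_sub ν
  have hk_im : ∀ z : ℂ, 0 < z.im → b.im ≤ (hmu z + b).im := fun z hz => by
    rw [add_im]
    linarith [hmu_nonneg z hz]
  have hk_pick : SchwarzPick fun z => hmu z + b := by
    intro z w hz hw
    have h1 := hmu_nonneg z hz
    have h2 := hmu_nonneg w hw
    simp only [add_sub_add_right_eq_sub, add_im]
    refine (hmu_pick z w hz hw).trans ?_
    gcongr <;> linarith
  have hk_lim : Tendsto (fun y : ℝ => (hmu (y * I) + b).im / y) atTop (𝓝 0) := by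
    have h1 := tendsto_im_inv_integral_sub_div μ
    have h2 : Tendsto (fun y : ℝ => b.im / y) atTop (𝓝 0) := tendsto_const_nhds.div_atTop tendsto_id
    simpa [hmu_eq, add_div] using h1.add h2
  have hf_im : ∀ z : ℂ, 0 < z.im → b.im ≤ (f z).im := fun z hz => by
    rw [hf, add_im]
    linarith [hnu_nonneg _ (hb.trans_le (hk_im z hz))]
  have hf_pick : SchwarzPick fun z => f z - b.im * I := by
    intro z w hz hw
    have hkz := hb.trans_le (hk_im z hz)
    have hkw := hb.trans_le (hk_im w hw)
    have h1 := hk_pick z w hz hw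
    have h2 := hnu_pick _ _ hkz hkw
    have hz1 := hnu_nonneg _ hkz
    have hw1 := hnu_nonneg _ hkw
    have him : ∀ z, (f z - b.im * I).im = (hnu (hmu z + b)).im := fun z => by simp [hf]
    have hsub : f z - b.im * I - (f w - b.im * I) = hnu (hmu z + b) - hnu (hmu w + b) := by
      rw [hf, hf]
      ring
    simp only [him, hsub]
    simp only at h1
    generalize hmu z + b = Z at *
    generalize hmu w + b = W at *
    refine le_of_mul_le_mul_right (a := Z.im * W.im) ?_ (by positivity)
    calc ‖hnu Z - hnu W‖ ^ 2 * (z.im * w.im) * (Z.im * W.im)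
        = (‖hnu Z - hnu W‖ ^ 2 * (Z.im * W.im)) * (z.im * w.im) := by ring
      _ ≤ (‖Z - W‖ ^ 2 * ((hnu Z).im * (hnu W).im)) * (z.im * w.im) := by gcongr
      _ = (‖Z - W‖ ^ 2 * (z.im * w.im)) * ((hnu Z).im * (hnu W).im) := by ring
      _ ≤ (‖z - w‖ ^ 2 * (Z.im * W.im)) * ((hnu Z).im * (hnu W).im) := by gcongr
      _ = _ := by ring
  obtain ⟨p, hp, hfp⟩ := exists_im_comp_add_lt hnu_pick hk_pick hnu_nonneg hb hk_im hk_lim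
  have hfp' : (f p).im < p.im := by
    rw [hf, add_im]
    exact hfp
  obtain ⟨w, hwb, hfw, -⟩ := exists_tendsto_iterate hb hf_im hf_pick hp hfp' le_rfl
  have hw := hb.trans_le hwb
  have huniq : ∀ w' : ℂ, 0 < w'.im → f w' = w' → w' = w := fun w' hw' hfw' =>
    eq_of_isFixedPt_of_schwarzPick hb hf_im hf_pick hw' hw hfw' hfw
  refine ⟨w, ⟨hw, hfw⟩, huniq, hwb, fun ω hω => ?_⟩
  obtain ⟨w', hwb', hfw', hlim⟩ := exists_tendsto_iterate hb hf_im hf_pick hp hfp' (hf_im ω hω)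
  rw [huniq w' (hb.trans_le hwb') hfw'] at hlim
  rw [← tendsto_add_atTop_iff_nat 1]
  simpa only [Function.iterate_succ_apply] using hlim
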